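/- arXiv:2007.06967 — 2 statements merged into one kernel-verified Lean document; each statement's English description precedes it below -/
import Mathlib

section
/- Let G be a finite connected graph with positive edge weights and PTDF matrix V = B C L⁺. For every edge ℓ = {1, j} incident to node 1, one has V_{ℓ,1} ≥ 0 if and only if ℓ is oriented out of node 1, i.e., C_{ℓ,1} = 1 and C_{ℓ,j} = −1. In particular, if the orientation is chosen so that every edge incident to node 1 is oriented out of node 1, then V_{ℓ,1} ≥ 0 for all such edges ℓ. -/
open Matrix

/-- Each row of `C` is the signed indicator `e_i - e_j` of an oriented edge `(i, j)`. -/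
def IsOrientedIncidence {E N : Type*} (C : Matrix E N ℝ) : Prop :=
  ∀ ℓ : E, ∃ i j : N, i ≠ j ∧ C ℓ i = 1 ∧ C ℓ j = -1 ∧ ∀ k : N, k ≠ i → k ≠ j → C ℓ k = 0

section

variable {E N : Type*} {C : Matrix E N ℝ}

theorem weightedLaplacian_isSymm [Fintype E] [DecidableEq E] (C : Matrix E N ℝ) (β : E → ℝ) :
    (Cᵀ * diagonal β * C).IsSymm := by
  simp [IsSymm, transpose_mul, Matrix.mul_assoc]

variable [Fintype N]

theorem incidence_mulVec_apply {ℓ : E} {i j : N} (hij : i ≠ j) (hi : C ℓ i = 1) (hj : C ℓ j = -1)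
    (h : ∀ k : N, k ≠ i → k ≠ j → C ℓ k = 0) (x : N → ℝ) : (C *ᵥ x) ℓ = x i - x j := by
  classical
  rw [mulVec, dotProduct, Finset.sum_eq_add i j hij]
  · rw [hi, hj]; ring
  · rintro k - ⟨hki, hkj⟩
    rw [h k hki hkj, zero_mul]
  · simp
  · simp

theorem IsOrientedIncidence.mulVec_const (hC : IsOrientedIncidence C) (a : ℝ) :
    C *ᵥ (fun _ => a) = 0 := by
  ext ℓ
  obtain ⟨i, j, hij, hi, hj, h⟩ := hC ℓ
  simp [incidence_mulVec_apply hij hi hj h]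

theorem IsOrientedIncidence.apply_eq_of_mulVec_eq_zero (hC : IsOrientedIncidence C)
    (hconn : (SimpleGraph.fromRel (fun i j : N => ∃ ℓ : E, C ℓ i ≠ 0 ∧ C ℓ j ≠ 0)).Connected)
    {x : N → ℝ} (hx : C *ᵥ x = 0) (u v : N) : x u = x v := by
  have hedge (ℓ : E) (a b : N) (ha : C ℓ a ≠ 0) (hb : C ℓ b ≠ 0) : x a = x b := by
    obtain ⟨i, j, hij, hi, hj, h⟩ := hC ℓ
    have hxij : x i - x j = 0 := by rw [← incidence_mulVec_apply hij hi hj h, hx, Pi.zero_apply]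
    have hend (c : N) (hc : C ℓ c ≠ 0) : x c = x i := by
      by_cases hci : c = i
      · rw [hci]
      by_cases hcj : c = j
      · rw [hcj]; linarith
      exact absurd (h c hci hcj) hc
    rw [hend a ha, hend b hb]
  obtain ⟨p⟩ := hconn.preconnected u v
  induction p with
  | nil => rfl
  | cons hadj _ ih =>
    rw [← ih]
    obtain ⟨-, ⟨ℓ, ha, hb⟩ | ⟨ℓ, hb, ha⟩⟩ := (SimpleGraph.fromRel_adj _ _ _).1 hadj <;>
      exact hedge ℓ _ _ ha hb

variable [Fintype E] [DecidableEq E]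

theorem weightedLaplacian_mulVec_apply (C : Matrix E N ℝ) (β : E → ℝ) (x : N → ℝ) (k : N) :
    ((Cᵀ * diagonal β * C) *ᵥ x) k = ∑ ℓ, β ℓ * (C ℓ k * (C *ᵥ x) ℓ) := by
  rw [← mulVec_mulVec, ← mulVec_mulVec, mulVec, dotProduct]
  refine Finset.sum_congr rfl fun ℓ _ => ?_
  rw [mulVec_diagonal, transpose_apply]
  ring

/-- The kernel of a positively weighted Laplacian is the kernel of the incidence matrix. -/
theorem incidence_mulVec_eq_zero_of_weightedLaplacian {β : E → ℝ} (hβ : ∀ ℓ, 0 < β ℓ) {x : N → ℝ}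
    (hx : (Cᵀ * diagonal β * C) *ᵥ x = 0) : C *ᵥ x = 0 := by
  have hquad : ∑ ℓ, β ℓ * (C *ᵥ x) ℓ ^ 2 = 0 := by
    have h : x ⬝ᵥ ((Cᵀ * diagonal β * C) *ᵥ x) = 0 := by rw [hx, dotProduct_zero]
    rw [← mulVec_mulVec, ← mulVec_mulVec, dotProduct_mulVec, vecMul_transpose, dotProduct] at h
    rw [← h]
    refine Finset.sum_congr rfl fun ℓ _ => ?_
    rw [mulVec_diagonal]
    ring
  rw [Finset.sum_eq_zero_iff_of_nonneg
    fun ℓ _ => mul_nonneg (hβ ℓ).le (sq_nonneg _)] at hquad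
  ext ℓ
  simpa [(hβ ℓ).ne'] using hquad ℓ (Finset.mem_univ ℓ)

/-- The range projection of a connected weighted Laplacian has negative off-diagonal entries. -/
theorem IsOrientedIncidence.weightedLaplacian_mul_apply_neg (hC : IsOrientedIncidence C)
    (hconn : (SimpleGraph.fromRel (fun i j : N => ∃ ℓ : E, C ℓ i ≠ 0 ∧ C ℓ j ≠ 0)).Connected)
    {β : E → ℝ} (hβ : ∀ ℓ, 0 < β ℓ) {L M : Matrix N N ℝ} (hL : L = Cᵀ * diagonal β * C)
    (hLML : L * M * L = L) (hLM : (L * M)ᵀ = L * M) {k o : N} (hk : k ≠ o) : (L * M) k o < 0 := by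
  classical
  have hsymm : Lᵀ = L := hL ▸ weightedLaplacian_isSymm C β
  set Q : Matrix N N ℝ := 1 - L * M with hQ
  have hLQ : L * Q = 0 := by
    have h : (L * M * L)ᵀ = L * (L * M) := by rw [transpose_mul, hsymm, hLM]
    rw [hQ, Matrix.mul_sub, Matrix.mul_one, ← h, hLML, hsymm, sub_self]
  have hconst (i j : N) : Q i o = Q j o := by
    refine hC.apply_eq_of_mulVec_eq_zero hconn (x := fun i => Q i o)
      (incidence_mulVec_eq_zero_of_weightedLaplacian hβ ?_) i j
    ext i
    rw [← hL]
    exact congrFun (congrFun hLQ i) o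
  have hone : (fun _ => 1) ᵥ* L = 0 := by
    rw [← mulVec_transpose, hsymm, hL, ← mulVec_mulVec, hC.mulVec_const, mulVec_zero]
  have hsum : ∑ i, (L * M) i o = 0 := by
    have h : (fun _ => (1 : ℝ)) ᵥ* (L * M) = 0 := by
      rw [← vecMul_vecMul, hone, zero_vecMul]
    simpa [vecMul, dotProduct] using congrFun h o
  have hQsum : ∑ i, Q i o = 1 := by
    simp [hQ, Finset.sum_sub_distrib, hsum, one_apply]
  rw [Finset.sum_congr rfl fun i _ => hconst i k, Finset.sum_const, nsmul_eq_mul] at hQsum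
  have hpos : 0 < Q k o := by
    by_contra hle
    have := mul_nonpos_of_nonneg_of_nonpos
      (Nat.cast_nonneg (α := ℝ) (Finset.univ : Finset N).card) (not_lt.1 hle)
    linarith
  simpa [hQ, one_apply_ne hk] using hpos

/-- Maximum principle: a potential whose Laplacian is negative away from `o` has its unique maximum
at `o`. -/
theorem IsOrientedIncidence.lt_of_weightedLaplacian_neg (hC : IsOrientedIncidence C)
    {β : E → ℝ} (hβ : ∀ ℓ, 0 < β ℓ) {x : N → ℝ} {o : N}
    (hneg : ∀ k, k ≠ o → ((Cᵀ * diagonal β * C) *ᵥ x) k < 0) {j : N} (hj : j ≠ o) : x j < x o := by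
  have hmax (k : N) (hk : ∀ i, x i ≤ x k) : k = o := by
    by_contra hko
    refine (hneg k hko).not_ge ?_
    rw [weightedLaplacian_mulVec_apply]
    refine Finset.sum_nonneg fun ℓ _ => mul_nonneg (hβ ℓ).le ?_
    obtain ⟨a, b, hab, ha, hb, h⟩ := hC ℓ
    rw [incidence_mulVec_apply hab ha hb h]
    by_cases hka : k = a
    · subst hka; rw [ha]; linarith [hk b]
    by_cases hkb : k = b
    · subst hkb; rw [hb]; linarith [hk a]
    rw [h k hka hkb, zero_mul]
  have : Nonempty N := ⟨o⟩
  obtain ⟨k, hk⟩ := Finite.exists_max x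
  obtain rfl := hmax k hk
  refine (hk j).lt_of_ne fun hjk => hj (hmax j fun i => ?_)
  rw [hjk]
  exact hk i

end

/-- For every edge `ℓ = {1, j}` incident to node `1` (index `0`), the PTDF entry
`V ℓ 1` is nonnegative if and only if `ℓ` is oriented out of node `1`, i.e.
`C ℓ 1 = 1` and `C ℓ j = -1`.  In particular, if the orientation is chosen so that
every edge incident to node `1` is oriented out of node `1`, then `V ℓ 1 ≥ 0` for
every such edge. -/
theorem stmt_5
    (n m : ℕ) (hn : 2 ≤ n)
    (C : Matrix (Fin m) (Fin n) ℝ)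
    (hC : ∀ ℓ : Fin m, ∃ i j : Fin n, i ≠ j ∧ C ℓ i = 1 ∧ C ℓ j = -1 ∧
      ∀ k : Fin n, k ≠ i → k ≠ j → C ℓ k = 0)
    (hconn : (SimpleGraph.fromRel
      (fun i j : Fin n => ∃ ℓ : Fin m, C ℓ i ≠ 0 ∧ C ℓ j ≠ 0)).Connected)
    (β : Fin m → ℝ) (hβ : ∀ ℓ, 0 < β ℓ)
    (L : Matrix (Fin n) (Fin n) ℝ)
    (hL : L = Cᵀ * Matrix.diagonal β * C)
    (Lplus : Matrix (Fin n) (Fin n) ℝ)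
    (hMP : L * Lplus * L = L ∧ Lplus * L * Lplus = Lplus ∧
      (L * Lplus)ᵀ = L * Lplus ∧ (Lplus * L)ᵀ = Lplus * L)
    (V : Matrix (Fin m) (Fin n) ℝ)
    (hV : V = Matrix.diagonal β * C * Lplus) :
    (∀ (ℓ : Fin m) (j : Fin n), j ≠ (⟨0, by omega⟩ : Fin n) →
      C ℓ (⟨0, by omega⟩ : Fin n) ≠ 0 → C ℓ j ≠ 0 →
      (0 ≤ V ℓ (⟨0, by omega⟩ : Fin n) ↔
        (C ℓ (⟨0, by omega⟩ : Fin n) = 1 ∧ C ℓ j = -1))) ∧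
    ((∀ ℓ : Fin m, C ℓ (⟨0, by omega⟩ : Fin n) ≠ 0 →
        C ℓ (⟨0, by omega⟩ : Fin n) = 1) →
      ∀ ℓ : Fin m, C ℓ (⟨0, by omega⟩ : Fin n) ≠ 0 →
        0 ≤ V ℓ (⟨0, by omega⟩ : Fin n)) := by
  have hlt (j : Fin n) (hj : j ≠ ⟨0, by omega⟩) :
      Lplus j ⟨0, by omega⟩ < Lplus ⟨0, by omega⟩ ⟨0, by omega⟩ := by
    refine IsOrientedIncidence.lt_of_weightedLaplacian_neg hC hβ
      (x := fun i => Lplus i ⟨0, by omega⟩) (fun k hk => ?_) hj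
    rw [← hL]
    exact IsOrientedIncidence.weightedLaplacian_mul_apply_neg hC hconn hβ hL hMP.1 hMP.2.2.1 hk
  have hV_apply (ℓ : Fin m) (i j o : Fin n) (hij : i ≠ j) (hi : C ℓ i = 1) (hj : C ℓ j = -1)
      (h : ∀ k : Fin n, k ≠ i → k ≠ j → C ℓ k = 0) :
      V ℓ o = β ℓ * (Lplus i o - Lplus j o) := by
    rw [hV, Matrix.mul_assoc, diagonal_mul]
    exact congrArg _ (incidence_mulVec_apply hij hi hj h fun i => Lplus i o)
  constructor
  · intro ℓ j hj0 h0 hj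
    obtain ⟨a, b, hab, ha, hb, h⟩ := hC ℓ
    rw [hV_apply ℓ a b _ hab ha hb h, mul_nonneg_iff_of_pos_left (hβ ℓ), sub_nonneg]
    by_cases ha0 : a = ⟨0, by omega⟩
    · have hjb : j = b := by
        by_contra hjb
        exact hj (h j (ha0 ▸ hj0) hjb)
      subst hjb ha0
      exact ⟨fun _ => ⟨ha, hb⟩, fun _ => (hlt j hj0).le⟩
    · have hb0 : b = ⟨0, by omega⟩ := by
        by_contra hb0
        exact h0 (h _ (Ne.symm ha0) (Ne.symm hb0))
      subst hb0
      refine ⟨fun hle => absurd hle (hlt a ha0).not_ge, fun hone => ?_⟩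
      rw [hb] at hone
      norm_num at hone
  · intro hout ℓ h0
    have hone := hout ℓ h0
    obtain ⟨a, b, hab, ha, hb, h⟩ := hC ℓ
    have hb0 : b ≠ ⟨0, by omega⟩ := by
      rintro rfl
      rw [hb] at hone
      norm_num at hone
    obtain rfl : a = ⟨0, by omega⟩ := by
      by_contra ha0
      exact h0 (h _ (Ne.symm ha0) (Ne.symm hb0))
    rw [hV_apply ℓ _ b _ hab ha hb h]
    exact mul_nonneg (hβ ℓ).le (sub_nonneg.2 (hlt b hb0).le)
end

section
/- Let G be a finite connected graph on n ≥ 2 nodes with positive edge weights and PTDF matrix V = B C L⁺, and fix λ ∈ (0, 1]. For each d ∈ ℝⁿ let g*(d) denote the unique minimizer of g ↦ (1/2)‖g‖² over the nonempty closed convex set {g ∈ ℝⁿ : eᵀ g = eᵀ d and |(V(g − d))_ℓ| ≤ λ |(V d)_ℓ| for every edge ℓ}. Then the map d ↦ g*(d) is continuous on ℝⁿ. -/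
open Matrix

open Filter Topology

/-- The set of vectors balancing `d` whose deviation from `d` has flows bounded by `lam` times the
flows of `d`. -/
def flowFeasible {m n : ℕ} (V : Matrix (Fin m) (Fin n) ℝ) (lam : ℝ) (d : Fin n → ℝ) :
    Set (Fin n → ℝ) :=
  {g | (∑ i, g i = ∑ i, d i) ∧ ∀ ℓ : Fin m, |(V *ᵥ (g - d)) ℓ| ≤ lam * |(V *ᵥ d) ℓ|}

section

variable {m n : ℕ} {V : Matrix (Fin m) (Fin n) ℝ} {lam : ℝ}

theorem self_mem_flowFeasible (hlam : 0 ≤ lam) (d : Fin n → ℝ) : d ∈ flowFeasible V lam d :=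
  ⟨rfl, fun ℓ => by simpa using mul_nonneg hlam (abs_nonneg _)⟩

theorem continuous_mulVec_apply (V : Matrix (Fin m) (Fin n) ℝ) (ℓ : Fin m) :
    Continuous fun x : Fin n → ℝ => (V *ᵥ x) ℓ :=
  (continuous_apply ℓ).comp (continuous_const.matrix_mulVec continuous_id)

theorem midpoint_mem_flowFeasible {d x y : Fin n → ℝ} (hx : x ∈ flowFeasible V lam d)
    (hy : y ∈ flowFeasible V lam d) :
    (fun i => (x i + y i) / 2) ∈ flowFeasible V lam d := by
  refine ⟨?_, fun ℓ => ?_⟩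
  · rw [← Finset.sum_div, Finset.sum_add_distrib, hx.1, hy.1]
    ring
  · have key : (fun i => (x i + y i) / 2) - d = (1 / 2 : ℝ) • ((x - d) + (y - d)) := by
      ext i
      simp only [Pi.sub_apply, Pi.smul_apply, Pi.add_apply, smul_eq_mul]
      ring
    have hx' := abs_le.1 (hx.2 ℓ)
    have hy' := abs_le.1 (hy.2 ℓ)
    rw [key, mulVec_smul, mulVec_add, Pi.smul_apply, Pi.add_apply, smul_eq_mul, abs_le]
    constructor <;> linarith [hx'.1, hx'.2, hy'.1, hy'.2]

theorem eq_of_isMinOn_of_sum_sq_le {d x y : Fin n → ℝ} (hx : x ∈ flowFeasible V lam d)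
    (hmin : IsMinOn (fun g : Fin n → ℝ => ∑ i, g i ^ 2) (flowFeasible V lam d) x)
    (hy : y ∈ flowFeasible V lam d) (hle : ∑ i, y i ^ 2 ≤ ∑ i, x i ^ 2) : y = x := by
  have h := isMinOn_iff.1 hmin _ (midpoint_mem_flowFeasible hx hy)
  have hpar : ∑ i, ((x i + y i) / 2) ^ 2 + ∑ i, ((y i - x i) / 2) ^ 2 =
      (∑ i, x i ^ 2) / 2 + (∑ i, y i ^ 2) / 2 := by
    rw [Finset.sum_div, Finset.sum_div, ← Finset.sum_add_distrib, ← Finset.sum_add_distrib]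
    exact Finset.sum_congr rfl fun i _ => by ring
  have hzero : ∑ i, ((y i - x i) / 2) ^ 2 = 0 :=
    le_antisymm (by linarith) (Finset.sum_nonneg fun i _ => sq_nonneg _)
  rw [Finset.sum_eq_zero_iff_of_nonneg fun i _ => sq_nonneg _] at hzero
  ext i
  have := pow_eq_zero_iff (two_ne_zero) |>.1 (hzero i (Finset.mem_univ i))
  linarith

/-- Shrinking a feasible deviation makes it feasible for all nearby demands. -/
theorem eventually_add_smul_mem_flowFeasible (hlam : 0 ≤ lam) {d₀ g₀ : Fin n → ℝ}
    (hg₀ : g₀ ∈ flowFeasible V lam d₀) {s : ℝ} (hs₀ : 0 ≤ s) (hs₁ : s < 1) :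
    ∀ᶠ d in 𝓝 d₀, d + s • (g₀ - d₀) ∈ flowFeasible V lam d := by
  have hbound : ∀ ℓ, ∀ᶠ d in 𝓝 d₀, s * |(V *ᵥ (g₀ - d₀)) ℓ| ≤ lam * |(V *ᵥ d) ℓ| := by
    intro ℓ
    have hℓ := hg₀.2 ℓ
    rcases (abs_nonneg ((V *ᵥ (g₀ - d₀)) ℓ)).eq_or_lt with h | h
    · exact Eventually.of_forall fun d => by
        rw [← h, mul_zero]
        exact mul_nonneg hlam (abs_nonneg _)
    · have hlt : s * |(V *ᵥ (g₀ - d₀)) ℓ| < lam * |(V *ᵥ d₀) ℓ| := by nlinarith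
      have hcont : Continuous fun d : Fin n → ℝ => lam * |(V *ᵥ d) ℓ| :=
        continuous_const.mul (continuous_mulVec_apply V ℓ).abs
      exact (hcont.continuousAt.eventually_const_lt hlt).mono fun d => le_of_lt
  filter_upwards [eventually_all.2 hbound] with d hd
  refine ⟨?_, fun ℓ => ?_⟩
  · simp only [Pi.add_apply, Pi.smul_apply, Pi.sub_apply, smul_eq_mul, Finset.sum_add_distrib,
      ← Finset.mul_sum, Finset.sum_sub_distrib, hg₀.1]
    ring
  · rw [add_sub_cancel_left, mulVec_smul, Pi.smul_apply, smul_eq_mul, abs_mul, abs_of_nonneg hs₀]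
    exact hd ℓ

theorem mem_flowFeasible_of_tendsto {α : Type*} {u : Filter α} [u.NeBot]
    {g d : α → Fin n → ℝ} {x d₀ : Fin n → ℝ} (hg : Tendsto g u (𝓝 x)) (hd : Tendsto d u (𝓝 d₀))
    (h : ∀ a, g a ∈ flowFeasible V lam (d a)) : x ∈ flowFeasible V lam d₀ := by
  have hsum : Continuous fun y : Fin n → ℝ => ∑ i, y i := by fun_prop
  refine ⟨?_, fun ℓ => ?_⟩
  · refine tendsto_nhds_unique ((hsum.tendsto x).comp hg) ?_
    exact ((hsum.tendsto d₀).comp hd).congr fun a => (h a).1.symm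
  · have hV := continuous_mulVec_apply V ℓ
    exact le_of_tendsto_of_tendsto' ((hV.tendsto _).comp (hg.sub hd)).abs
      (((hV.tendsto _).comp hd).abs.const_mul lam) fun a => (h a).2 ℓ

theorem continuous_of_isMinOn_flowFeasible (hlam : 0 ≤ lam) {gstar : (Fin n → ℝ) → (Fin n → ℝ)}
    (hmem : ∀ d, gstar d ∈ flowFeasible V lam d)
    (hmin : ∀ d, IsMinOn (fun g : Fin n → ℝ => ∑ i, g i ^ 2) (flowFeasible V lam d) (gstar d)) :
    Continuous gstar := by
  have hq : Continuous fun g : Fin n → ℝ => ∑ i, g i ^ 2 := by fun_prop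
  refine continuous_iff_continuousAt.2 fun d₀ => ?_
  refine (tendsto_iff_ultrafilter _ _ _).2 fun u hu => ?_
  have hbdd : ∀ᶠ d in 𝓝 d₀, gstar d ∈
      Metric.closedBall (0 : Fin n → ℝ) (√(∑ i, d₀ i ^ 2 + 1)) := by
    filter_upwards [hq.continuousAt.eventually_lt_const (lt_add_one (∑ i, d₀ i ^ 2))] with d hd
    rw [mem_closedBall_zero_iff, pi_norm_le_iff_of_nonneg (Real.sqrt_nonneg _)]
    intro i
    refine Real.abs_le_sqrt ?_
    calc gstar d i ^ 2 ≤ ∑ j, gstar d j ^ 2 :=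
          Finset.single_le_sum (f := fun j => gstar d j ^ 2) (fun j _ => sq_nonneg _)
            (Finset.mem_univ i)
      _ ≤ ∑ j, d j ^ 2 := isMinOn_iff.1 (hmin d) d (self_mem_flowFeasible hlam d)
      _ ≤ _ := hd.le
  obtain ⟨x, -, hx⟩ := (isCompact_closedBall _ _).ultrafilter_le_nhds (u.map gstar)
    (le_principal_iff.2 (hu hbdd))
  have hgx : Tendsto gstar u (𝓝 x) := hx
  have hxmem : x ∈ flowFeasible V lam d₀ := mem_flowFeasible_of_tendsto hgx hu hmem
  have hle : ∀ s ∈ Set.Ico (0 : ℝ) 1,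
      ∑ i, x i ^ 2 ≤ ∑ i, (d₀ + s • (gstar d₀ - d₀)) i ^ 2 := by
    intro s hs
    have hadd : Continuous fun d : Fin n → ℝ => d + s • (gstar d₀ - d₀) :=
      continuous_id.add continuous_const
    refine le_of_tendsto_of_tendsto ((hq.tendsto x).comp hgx)
      (((hq.comp hadd).tendsto d₀).mono_left hu) (hu ?_)
    filter_upwards [eventually_add_smul_mem_flowFeasible hlam (hmem d₀) hs.1 hs.2] with d hd
    exact isMinOn_iff.1 (hmin d) _ hd
  have hlim : Tendsto (fun s : ℝ => ∑ i, (d₀ + s • (gstar d₀ - d₀)) i ^ 2) (𝓝[<] 1)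
      (𝓝 (∑ i, (d₀ + (1 : ℝ) • (gstar d₀ - d₀)) i ^ 2)) := by
    have hline : Continuous fun s : ℝ => d₀ + s • (gstar d₀ - d₀) := by fun_prop
    exact ((hq.comp hline).tendsto 1).mono_left nhdsWithin_le_nhds
  rw [one_smul, add_sub_cancel] at hlim
  have hxle : ∑ i, x i ^ 2 ≤ ∑ i, gstar d₀ i ^ 2 :=
    ge_of_tendsto hlim (by
      filter_upwards [Ico_mem_nhdsLT (zero_lt_one' ℝ)] with s hs using hle s hs)
  rwa [eq_of_isMinOn_of_sum_sq_le (hmem d₀) (hmin d₀) hxmem hxle] at hgx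

end

/-- The operational DC-OPF optimal solution depends continuously on the demand vector:
if `g*(d)` denotes the unique minimizer of `g ↦ (1/2)‖g‖²` over the nonempty closed
convex feasible set `{g : eᵀ g = eᵀ d, |V(g-d)| ≤ λ |V d|}`, then `d ↦ g*(d)` is
continuous. -/
theorem stmt_16
    (n m : ℕ) (hn : 2 ≤ n)
    (C : Matrix (Fin m) (Fin n) ℝ)
    (hC : ∀ ℓ : Fin m, ∃ i j : Fin n, i ≠ j ∧ C ℓ i = 1 ∧ C ℓ j = -1 ∧
      ∀ k : Fin n, k ≠ i → k ≠ j → C ℓ k = 0)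
    (hconn : (SimpleGraph.fromRel
      (fun i j : Fin n => ∃ ℓ : Fin m, C ℓ i ≠ 0 ∧ C ℓ j ≠ 0)).Connected)
    (β : Fin m → ℝ) (hβ : ∀ ℓ, 0 < β ℓ)
    (L : Matrix (Fin n) (Fin n) ℝ)
    (hL : L = Cᵀ * Matrix.diagonal β * C)
    (Lplus : Matrix (Fin n) (Fin n) ℝ)
    (hMP : L * Lplus * L = L ∧ Lplus * L * Lplus = Lplus ∧
      (L * Lplus)ᵀ = L * Lplus ∧ (Lplus * L)ᵀ = Lplus * L)
    (V : Matrix (Fin m) (Fin n) ℝ)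
    (hV : V = Matrix.diagonal β * C * Lplus)
    (lam : ℝ) (hlam : lam ∈ Set.Ioc (0 : ℝ) 1)
    (gstar : (Fin n → ℝ) → (Fin n → ℝ))
    (hgstar : ∀ d : Fin n → ℝ,
      ((∑ i, gstar d i = ∑ i, d i) ∧
        ∀ ℓ : Fin m, |(V *ᵥ (gstar d - d)) ℓ| ≤ lam * |(V *ᵥ d) ℓ|) ∧
      ∀ g : Fin n → ℝ,
        ((∑ i, g i = ∑ i, d i) ∧
          ∀ ℓ : Fin m, |(V *ᵥ (g - d)) ℓ| ≤ lam * |(V *ᵥ d) ℓ|) →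
        (1 / 2 : ℝ) * ∑ i, (gstar d i) ^ 2 ≤ (1 / 2 : ℝ) * ∑ i, (g i) ^ 2) :
    Continuous gstar := by
  refine continuous_of_isMinOn_flowFeasible (V := V) hlam.1.le (fun d => (hgstar d).1)
    fun d => isMinOn_iff.2 fun g hg => ?_
  have := (hgstar d).2 g hg
  linarith
end
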